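/- Suppose the linear functional ⟨·⟩ is reflection positive for reflections through edges, the two-point function G_L is torus symmetric, and G_L(x,y) ≤ M for all x, y ∈ T_L, where M ∈ (0,∞). For z ∈ T_L define Q_z := { x ∈ T_L : for every i ∈ {1,…,d}, either x·e_i ≤ |z·e_i| or x·e_i > L − |z·e_i| } (coordinates of x taken in [0,L), and |z·e_i| the absolute value of the representative of z·e_i in (−L/2,L/2]). Then for any z ∈ T_L and any y ∈ Q_z such that all coordinates z·e_i and all coordinates y·e_i are odd, one has G_L(o, y) ≥ 2^d G_L(o, z) − (2^d − 1) M. -/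

import Mathlib

namespace RPPaper

/-- The torus `T_L = (ℤ/Lℤ)^d`. -/
abbrev Torus (d L : ℕ) : Type := Fin d → ZMod L

/-- The unit vector `e i`. -/
def unitVec {d L : ℕ} (i : Fin d) : Torus d L := fun k => if k = i then 1 else 0

/-- The point `a • e i` on the torus. -/
def axis {d L : ℕ} (i : Fin d) (a : ZMod L) : Torus d L := fun k => if k = i then a else 0

/-- The integer representative of `a : ZMod L` in the interval `(-L/2, L/2]`. -/
def coordRep (L : ℕ) [NeZero L] (a : ZMod L) : ℤ :=
  if (a.val : ℤ) ≤ (L : ℤ) / 2 then (a.val : ℤ) else (a.val : ℤ) - (L : ℤ)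

/-- The reflection of the torus in the hyperplane `{z : z·e i = t/2}` (here `t = 2m`);
it is a reflection through edges if `t` is odd, and through vertices if `t` is even. -/
def reflect {d L : ℕ} (i : Fin d) (t : ℕ) (x : Torus d L) : Torus d L :=
  Function.update x i ((t : ZMod L) - x i)

/-- The positive half `T_L^+` of the torus associated to the reflection in the hyperplane
`{z : z·e i = t/2}`. -/
def posHalf (d L : ℕ) [NeZero L] (i : Fin d) (t : ℕ) : Finset (Torus d L) :=
  if t % 2 = 1 then Finset.univ.filter (fun x => (x i - (((t + 1) / 2 : ℕ) : ZMod L)).val < L / 2)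
  else Finset.univ.filter (fun x => (x i - ((t / 2 : ℕ) : ZMod L)).val ≤ L / 2)

/-- The negative half `T_L^- = θ(T_L^+)`. -/
def negHalf (d L : ℕ) [NeZero L] (i : Fin d) (t : ℕ) : Finset (Torus d L) :=
  (posHalf d L i t).image (reflect i t)

/-- The state space `S = ∏_{x ∈ T_L} Σ_x` (all local state spaces equal to `Sig`). -/
abbrev MState (d L : ℕ) (Sig : Type*) : Type _ := Torus d L → Sig

/-- `A : S → ℝ` has domain `D` if it depends only on the local states in `D`. -/
def HasDomain {d L : ℕ} {Sig : Type*} (A : MState d L Sig → ℝ) (D : Set (Torus d L)) : Prop :=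
  ∀ w₁ w₂ : MState d L Sig, (∀ x ∈ D, w₁ x = w₂ x) → A w₁ = A w₂

/-- The action `θA (w) = A (θ w)`, where `(θ w) x = w (θ x)`, of the reflection on functions. -/
def reflectFun {d L : ℕ} {Sig : Type*} (i : Fin d) (t : ℕ) (A : MState d L Sig → ℝ) :
    MState d L Sig → ℝ := fun w => A (fun x => w (reflect i t x))

/-- `⟨·⟩` is reflection positive with respect to the reflection in the hyperplane
`{z : z·e i = t/2}`: for all `A, B ∈ A_L^+` (members of the algebra with domain `T_L^+`),
`⟨A·θB⟩ = ⟨B·θA⟩` and `⟨A·θA⟩ ≥ 0`. -/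
def IsRP {d L : ℕ} {Sig : Type*} [NeZero L] (AL : Subalgebra ℝ (MState d L Sig → ℝ))
    (phi : (MState d L Sig → ℝ) →ₗ[ℝ] ℝ) (i : Fin d) (t : ℕ) : Prop :=
  ∀ A B : MState d L Sig → ℝ, A ∈ AL → B ∈ AL →
    HasDomain A ↑(posHalf d L i t) → HasDomain B ↑(posHalf d L i t) →
    phi (A * reflectFun i t B) = phi (B * reflectFun i t A) ∧ 0 ≤ phi (A * reflectFun i t A)

/-- Reflection positivity for all reflections through edges. -/
def RPEdges {d L : ℕ} {Sig : Type*} [NeZero L] (AL : Subalgebra ℝ (MState d L Sig → ℝ))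
    (phi : (MState d L Sig → ℝ) →ₗ[ℝ] ℝ) : Prop :=
  ∀ (i : Fin d) (t : ℕ), t < 2 * L → t % 2 = 1 → IsRP AL phi i t

/-- Reflection positivity for all reflections through vertices. -/
def RPVertices {d L : ℕ} {Sig : Type*} [NeZero L] (AL : Subalgebra ℝ (MState d L Sig → ℝ))
    (phi : (MState d L Sig → ℝ) →ₗ[ℝ] ℝ) : Prop :=
  ∀ (i : Fin d) (t : ℕ), t < 2 * L → t % 2 = 0 → IsRP AL phi i t

/-- The single-site function `F^j_x`, obtained from a function `f : Sig → ℝ` of the local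
state at the origin by the (path-independent) sequence of reflections sending `o` to `x`. -/
def site {d L : ℕ} {Sig : Type*} (f : Sig → ℝ) (x : Torus d L) : MState d L Sig → ℝ :=
  fun w => f (w x)

/-- The two-point function `G_L(x,y) = ⟨F²_x F²_y ∏_{z ≠ x,y} F¹_z⟩`. -/
noncomputable def twoPoint {d L : ℕ} {Sig : Type*} [NeZero L]
    (phi : (MState d L Sig → ℝ) →ₗ[ℝ] ℝ) (f1 f2 : Sig → ℝ) (x y : Torus d L) : ℝ :=
  phi (fun w => f2 (w x) * f2 (w y) * ∏ z ∈ (Finset.univ.erase x).erase y, f1 (w z))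

/-- Torus symmetry: `⟨∏_{x∈A}F¹_x ∏_{x∈B}F²_x⟩ = ⟨∏_{x∈A+z}F¹_x ∏_{x∈B+z}F²_x⟩`. -/
def TorusSymmetric {d L : ℕ} {Sig : Type*} [NeZero L]
    (phi : (MState d L Sig → ℝ) →ₗ[ℝ] ℝ) (f1 f2 : Sig → ℝ) : Prop :=
  ∀ (A B : Finset (Torus d L)) (z : Torus d L),
    phi (fun w => (∏ x ∈ A, f1 (w x)) * ∏ x ∈ B, f2 (w x)) =
      phi (fun w => (∏ x ∈ A, f1 (w (x + z))) * ∏ x ∈ B, f2 (w (x + z)))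


/-- The set `Q_z` of points whose coordinates (taken in `[0,L)`) are either `≤ |z·e i|` or
`> L − |z·e i|` for every direction `i`. -/
def Qset (d L : ℕ) [NeZero L] (z : Torus d L) : Set (Torus d L) :=
  {x | ∀ i : Fin d,
    ((x i).val : ℤ) ≤ |coordRep L (z i)| ∨ (L : ℤ) - |coordRep L (z i)| < ((x i).val : ℤ)}

theorem le_of_midpoint_convex {f : ℕ → ℝ} {p q k : ℕ} (hpk : p ≤ k) (hkq : k ≤ q)
    (hconv : ∀ i, p ≤ i → i + 2 ≤ q → 2 * f (i + 1) ≤ f i + f (i + 2)) (hpq : f p = f q) :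
    f k ≤ f p := by
  by_contra! hk
  have hstep : ∀ n, p + n + 1 ≤ q → f (p + n + 1) ≤ f p ∨ f (p + n) < f (p + n + 1) := by
    intro n
    induction n with
    | zero => intro _; simpa using le_or_gt (f (p + 1)) (f p)
    | succ n ih =>
      intro hn
      have hc := hconv (p + n) (by omega) (by omega)
      rw [show p + (n + 1) + 1 = p + n + 2 by ring, show p + (n + 1) = p + n + 1 by ring]
      rcases ih (by omega) with h | h
      · rcases le_or_gt (f (p + n + 2)) (f p) with h' | h'
        · exact Or.inl h'
        · exact Or.inr (by linarith)
      · exact Or.inr (by linarith)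
  have hup : ∀ n, k + n ≤ q → f k ≤ f (k + n) := by
    intro n
    induction n with
    | zero => intro _; simp
    | succ n ih =>
      intro hn
      have h1 := ih (by omega)
      by_contra! h2
      obtain ⟨m, rfl⟩ : ∃ m, k = p + m + 1 := by
        refine ⟨k - p - 1, ?_⟩
        have : k ≠ p := by rintro rfl; exact lt_irrefl _ hk
        omega
      have hc := hconv (p + (m + n)) (by omega) (by omega)
      have hs := hstep (m + n) (by omega)
      rw [show p + m + 1 + (n + 1) = p + (m + n) + 2 by ring] at h2
      rw [show p + m + 1 + n = p + (m + n) + 1 by ring] at h1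
      rcases hs with h | h <;> linarith
  have := hup (q - k) (by omega)
  rw [show k + (q - k) = q by omega] at this
  linarith

theorem reflect_reflect {d L : ℕ} (i : Fin d) (t : ℕ) (x : Torus d L) :
    reflect i t (reflect i t x) = x := by
  simp [reflect]

section TwoPoint

variable {d L : ℕ} {Sig : Type*} [NeZero L] {AL : Subalgebra ℝ (MState d L Sig → ℝ)}
  {phi : (MState d L Sig → ℝ) →ₗ[ℝ] ℝ} {f1 f2 : Sig → ℝ}

theorem twoPoint_comm (x y : Torus d L) :
    twoPoint phi f1 f2 x y = twoPoint phi f1 f2 y x := by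
  unfold twoPoint
  simp only [Finset.erase_right_comm (a := x) (b := y), mul_comm (f2 (_ : Sig)) (f2 _)]

theorem twoPoint_eq_of_ne {x y : Torus d L} (hxy : x ≠ y) (hsym : TorusSymmetric phi f1 f2) :
    twoPoint phi f1 f2 x y = twoPoint phi f1 f2 0 (y - x) := by
  have h := hsym ((Finset.univ.erase x).erase y) {x, y} (-x)
  simp only [Finset.prod_pair hxy] at h
  have himg : ((Finset.univ.erase (0 : Torus d L)).erase (y - x)) =
      ((Finset.univ.erase x).erase y).map (Equiv.addRight (-x)).toEmbedding := by
    ext a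
    simp only [Finset.mem_erase, Finset.mem_univ, Finset.mem_map_equiv, and_true, ne_eq,
      Equiv.addRight_symm, Equiv.coe_addRight, neg_neg]
    rw [eq_sub_iff_add_eq, add_eq_right]
  unfold twoPoint
  rw [himg]
  simp only [Finset.prod_map, Equiv.coe_toEmbedding, Equiv.coe_addRight]
  simp only [add_neg_cancel, ← sub_eq_add_neg] at h ⊢
  simpa only [mul_comm, sub_self] using h

theorem twoPoint_zero_neg (hsym : TorusSymmetric phi f1 f2) (x : Torus d L) :
    twoPoint phi f1 f2 0 (-x) = twoPoint phi f1 f2 0 x := by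
  by_cases hx : x = 0
  · simp [hx]
  · rw [twoPoint_comm, twoPoint_eq_of_ne (by simpa using hx) hsym, zero_sub, neg_neg]

/-- The product of `F²` at `p` and of `F¹` at the other sites of the positive half. -/
noncomputable def halfFun (f1 f2 : Sig → ℝ) (i : Fin d) (p : Torus d L) : MState d L Sig → ℝ :=
  site f2 p * ∏ z ∈ (posHalf d L i 1).erase p, site f1 z

theorem halfFun_apply (i : Fin d) (p : Torus d L) (w : MState d L Sig) :
    halfFun f1 f2 i p w = f2 (w p) * ∏ z ∈ (posHalf d L i 1).erase p, f1 (w z) := by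
  simp [halfFun, site, Finset.prod_apply]

theorem halfFun_mem (hF1 : ∀ x : Torus d L, site f1 x ∈ AL) (hF2 : ∀ x : Torus d L, site f2 x ∈ AL)
    (i : Fin d) (p : Torus d L) : halfFun f1 f2 i p ∈ AL :=
  AL.mul_mem (hF2 p) (AL.prod_mem fun z _ => hF1 z)

theorem hasDomain_halfFun {i : Fin d} {p : Torus d L} (hp : p ∈ posHalf d L i 1) :
    HasDomain (halfFun f1 f2 i p) ↑(posHalf d L i 1) := by
  intro w₁ w₂ h
  rw [halfFun_apply, halfFun_apply, h p hp]
  congr 1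
  exact Finset.prod_congr rfl fun z hz => by rw [h z (Finset.mem_of_mem_erase hz)]

theorem mem_posHalf_one {i : Fin d} {x : Torus d L} :
    x ∈ posHalf d L i 1 ↔ (x i - 1).val < L / 2 := by
  simp [posHalf]

theorem val_neg_sub_one (a : ZMod L) : (-a - 1).val = L - 1 - a.val := by
  have hlt := ZMod.val_lt a
  have h : (-a - 1 : ZMod L) = ((L - 1 - a.val : ℕ) : ZMod L) := by
    rw [Nat.cast_sub (by omega), Nat.cast_sub (by omega)]
    simp
    ring
  rw [h, ZMod.val_natCast_of_lt (by omega)]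

theorem reflect_mem_posHalf_iff (hL : Even L) {i : Fin d} {x : Torus d L} :
    reflect i 1 x ∈ posHalf d L i 1 ↔ x ∉ posHalf d L i 1 := by
  rw [mem_posHalf_one, mem_posHalf_one]
  have h : reflect i 1 x i - 1 = -(x i - 1) - 1 := by
    simp [reflect]
  rw [h, val_neg_sub_one]
  have := ZMod.val_lt (x i - 1)
  obtain ⟨n, rfl⟩ := hL
  omega

theorem phi_halfFun_mul_reflectFun (hL : Even L) {i : Fin d} {p q : Torus d L}
    (hp : p ∈ posHalf d L i 1) (hq : q ∈ posHalf d L i 1) :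
    phi (halfFun f1 f2 i p * reflectFun i 1 (halfFun f1 f2 i q)) =
      twoPoint phi f1 f2 p (reflect i 1 q) := by
  unfold twoPoint
  congr 1
  funext w
  simp only [Pi.mul_apply, reflectFun, halfFun_apply]
  have hq' : reflect i 1 q ∉ posHalf d L i 1 := by
    rw [reflect_mem_posHalf_iff hL]; exact not_not.mpr hq
  have hinj : Function.Injective (reflect (L := L) i 1) :=
    Function.LeftInverse.injective (reflect_reflect i 1)
  have hset : (Finset.univ.erase p).erase (reflect i 1 q) =
      (posHalf d L i 1).erase p ∪ ((posHalf d L i 1).erase q).image (reflect i 1) := by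
    ext a
    simp only [Finset.mem_erase, Finset.mem_univ, and_true, Finset.mem_union, Finset.mem_image]
    by_cases ha : a ∈ posHalf d L i 1
    · have h1 : a ≠ reflect i 1 q := fun h => hq' (h ▸ ha)
      have h2 : ¬ ∃ b, (b ≠ q ∧ b ∈ posHalf d L i 1) ∧ reflect i 1 b = a := by
        rintro ⟨b, ⟨-, hb⟩, rfl⟩
        exact (reflect_mem_posHalf_iff hL).mp ha hb
      simp [h1, h2, ha]
    · have h1 : a ≠ p := fun h => ha (h ▸ hp)
      have ha' := (reflect_mem_posHalf_iff hL).mpr ha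
      simp only [h1, ha, ne_eq, not_false_eq_true, and_true, and_false, false_or]
      constructor
      · intro h
        exact ⟨reflect i 1 a, ⟨fun h' => h (by rw [← h', reflect_reflect]), ha'⟩,
          reflect_reflect i 1 a⟩
      · rintro ⟨b, ⟨hb, -⟩, rfl⟩ h
        exact hb (hinj h)
  have hdisj : Disjoint ((posHalf d L i 1).erase p)
      (((posHalf d L i 1).erase q).image (reflect i 1)) := by
    rw [Finset.disjoint_left]
    intro a ha ha'
    obtain ⟨b, hb, rfl⟩ := Finset.mem_image.mp ha'
    exact (reflect_mem_posHalf_iff hL).mp (Finset.mem_of_mem_erase ha) (Finset.mem_of_mem_erase hb)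
  rw [hset, Finset.prod_union hdisj, Finset.prod_image hinj.injOn]
  ring

theorem IsRP.two_mul_le {i : Fin d} {t : ℕ} (h : IsRP AL phi i t) {A B : MState d L Sig → ℝ}
    (hA : A ∈ AL) (hB : B ∈ AL) (hA' : HasDomain A ↑(posHalf d L i t))
    (hB' : HasDomain B ↑(posHalf d L i t)) :
    2 * phi (A * reflectFun i t B) ≤
      phi (A * reflectFun i t A) + phi (B * reflectFun i t B) := by
  have h1 := (h A B hA hB hA' hB').1
  have hdom : HasDomain (A - B) ↑(posHalf d L i t) := fun w₁ w₂ hw => by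
    simp only [Pi.sub_apply, hA' w₁ w₂ hw, hB' w₁ w₂ hw]
  have h2 := (h (A - B) (A - B) (AL.sub_mem hA hB) (AL.sub_mem hA hB) hdom hdom).2
  have h3 : (A - B) * reflectFun i t (A - B) =
      A * reflectFun i t A - A * reflectFun i t B - B * reflectFun i t A +
        B * reflectFun i t B := by
    funext w
    simp only [reflectFun, Pi.mul_apply, Pi.sub_apply, Pi.add_apply]
    ring
  rw [h3, map_add, map_sub, map_sub] at h2
  linarith

theorem update_mem_posHalf (i : Fin d) (u : Torus d L) {a : ℕ} (ha : a < L / 2) :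
    Function.update u i ((a : ZMod L) + 1) ∈ posHalf d L i 1 := by
  rw [mem_posHalf_one]
  simp only [Function.update_self, add_sub_cancel_right]
  rwa [ZMod.val_natCast_of_lt (by omega)]

theorem phi_halfFun_update (hL : Even L) (hsym : TorusSymmetric phi f1 f2) (i : Fin d)
    (u v : Torus d L) {a b : ℕ} (ha : a < L / 2) (hb : b < L / 2) :
    phi (halfFun f1 f2 i (Function.update u i ((a : ZMod L) + 1)) *
        reflectFun i 1 (halfFun f1 f2 i (Function.update v i ((b : ZMod L) + 1)))) =
      twoPoint phi f1 f2 0 (Function.update (u - v) i ((a + b + 1 : ℕ) : ZMod L)) := by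
  have hp := update_mem_posHalf i u ha
  have hq := update_mem_posHalf i v hb
  rw [phi_halfFun_mul_reflectFun hL hp hq, twoPoint_comm, twoPoint_eq_of_ne _ hsym]
  · congr 1
    funext k
    by_cases hk : k = i
    · subst hk
      simp [reflect]
      ring
    · simp [reflect, hk]
  · intro h
    rw [← h, reflect_mem_posHalf_iff hL] at hp
    exact hp hq

theorem RPEdges.isRP_one (hRP : RPEdges AL phi) (i : Fin d) : IsRP AL phi i 1 :=
  hRP i 1 (by have := NeZero.pos L; omega) rfl

theorem twoPoint_update_neg (hL : Even L) (hF1 : ∀ x : Torus d L, site f1 x ∈ AL)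
    (hF2 : ∀ x : Torus d L, site f2 x ∈ AL) (hRP : RPEdges AL phi)
    (hsym : TorusSymmetric phi f1 f2) (i : Fin d) (u : Torus d L) {a b : ℕ}
    (ha : a < L / 2) (hb : b < L / 2) :
    twoPoint phi f1 f2 0 (Function.update (-u) i ((a + b + 1 : ℕ) : ZMod L)) =
      twoPoint phi f1 f2 0 (Function.update u i ((a + b + 1 : ℕ) : ZMod L)) := by
  have h := (hRP.isRP_one i _ _ (halfFun_mem hF1 hF2 i _) (halfFun_mem hF1 hF2 i _)
    (hasDomain_halfFun (update_mem_posHalf i u ha))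
    (hasDomain_halfFun (update_mem_posHalf i 0 hb))).1
  rw [phi_halfFun_update hL hsym i u 0 ha hb, phi_halfFun_update hL hsym i 0 u hb ha, sub_zero,
    zero_sub, add_comm b a] at h
  exact h.symm

theorem twoPoint_update_le_axis (hL : Even L) (hF1 : ∀ x : Torus d L, site f1 x ∈ AL)
    (hF2 : ∀ x : Torus d L, site f2 x ∈ AL) (hRP : RPEdges AL phi)
    (hsym : TorusSymmetric phi f1 f2) (i : Fin d) (u : Torus d L) {a : ℕ} (ha : a < L / 2) :
    twoPoint phi f1 f2 0 (Function.update u i ((2 * a + 1 : ℕ) : ZMod L)) ≤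
      twoPoint phi f1 f2 0 (Function.update 0 i ((2 * a + 1 : ℕ) : ZMod L)) := by
  have h := (hRP.isRP_one i).two_mul_le (halfFun_mem hF1 hF2 i _) (halfFun_mem hF1 hF2 i _)
    (hasDomain_halfFun (update_mem_posHalf i u ha))
    (hasDomain_halfFun (update_mem_posHalf i 0 ha))
  simp only [phi_halfFun_update hL hsym i _ _ ha ha, sub_zero, sub_self, ← two_mul] at h
  linarith

/-- The sum of the two-point function at `n • e i` and at its translate by the part of `u`
orthogonal to `e i`. -/
noncomputable def lineSum (phi : (MState d L Sig → ℝ) →ₗ[ℝ] ℝ) (f1 f2 : Sig → ℝ) (i : Fin d)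
    (u : Torus d L) (n : ℕ) : ℝ :=
  twoPoint phi f1 f2 0 (Function.update u i (n : ZMod L)) +
    twoPoint phi f1 f2 0 (Function.update 0 i (n : ZMod L))

theorem two_mul_lineSum_le (hL : Even L) (hF1 : ∀ x : Torus d L, site f1 x ∈ AL)
    (hF2 : ∀ x : Torus d L, site f2 x ∈ AL) (hRP : RPEdges AL phi)
    (hsym : TorusSymmetric phi f1 f2) (i : Fin d) (u : Torus d L) {a b : ℕ}
    (ha : a < L / 2) (hb : b < L / 2) :
    2 * lineSum phi f1 f2 i u (a + b + 1) ≤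
      lineSum phi f1 f2 i u (2 * a + 1) + lineSum phi f1 f2 i u (2 * b + 1) := by
  let S : ℕ → MState d L Sig → ℝ := fun c =>
    halfFun f1 f2 i (Function.update u i ((c : ZMod L) + 1)) +
      halfFun f1 f2 i (Function.update 0 i ((c : ZMod L) + 1))
  have hmem (c : ℕ) : S c ∈ AL := AL.add_mem (halfFun_mem hF1 hF2 i _) (halfFun_mem hF1 hF2 i _)
  have hdom {c : ℕ} (hc : c < L / 2) : HasDomain (S c) ↑(posHalf d L i 1) := fun w₁ w₂ hw => by
    simp only [S, Pi.add_apply, hasDomain_halfFun (update_mem_posHalf i u hc) w₁ w₂ hw,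
      hasDomain_halfFun (update_mem_posHalf i 0 hc) w₁ w₂ hw]
  have hpair {a b : ℕ} (ha : a < L / 2) (hb : b < L / 2) :
      phi (S a * reflectFun i 1 (S b)) = 2 * lineSum phi f1 f2 i u (a + b + 1) := by
    have hadd (A B : MState d L Sig → ℝ) :
        reflectFun i 1 (A + B) = reflectFun i 1 A + reflectFun i 1 B := rfl
    simp only [S, hadd, add_mul, mul_add, map_add, phi_halfFun_update hL hsym i _ _ ha hb,
      sub_self, sub_zero, zero_sub, twoPoint_update_neg hL hF1 hF2 hRP hsym i u ha hb, lineSum]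
    ring
  have h := (hRP.isRP_one i).two_mul_le (hmem a) (hmem b) (hdom ha) (hdom hb)
  rw [hpair ha hb, hpair ha ha, hpair hb hb, ← two_mul a, ← two_mul b] at h
  linarith

theorem lineSum_reflect (hL : Even L) (hF1 : ∀ x : Torus d L, site f1 x ∈ AL)
    (hF2 : ∀ x : Torus d L, site f2 x ∈ AL) (hRP : RPEdges AL phi)
    (hsym : TorusSymmetric phi f1 f2) (i : Fin d) (u : Torus d L) {a b : ℕ} (hab : a + b + 1 = L / 2) :
    lineSum phi f1 f2 i u (2 * a + 1) = lineSum phi f1 f2 i u (2 * b + 1) := by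
  have hcast : ((2 * a + 1 : ℕ) : ZMod L) = -((2 * b + 1 : ℕ) : ZMod L) := by
    rw [eq_neg_iff_add_eq_zero, ← Nat.cast_add, show 2 * a + 1 + (2 * b + 1) = L by
      obtain ⟨n, rfl⟩ := hL
      omega, ZMod.natCast_self]
  have hneg (v : Torus d L) (c : ZMod L) :
      Function.update v i (-c) = -Function.update (-v) i c := by
    funext k
    by_cases hk : k = i
    · subst hk; simp
    · simp [hk]
  have hflip := twoPoint_update_neg hL hF1 hF2 hRP hsym i u (a := b) (b := b) (by omega) (by omega)
  rw [← two_mul b] at hflip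
  unfold lineSum
  rw [hcast, hneg u, hneg 0, twoPoint_zero_neg hsym, twoPoint_zero_neg hsym, neg_zero, hflip]

theorem lineSum_le (hL : Even L) (hF1 : ∀ x : Torus d L, site f1 x ∈ AL)
    (hF2 : ∀ x : Torus d L, site f2 x ∈ AL) (hRP : RPEdges AL phi)
    (hsym : TorusSymmetric phi f1 f2) (i : Fin d) (u : Torus d L) {p q k : ℕ} (hpq : p + q + 1 = L / 2)
    (hpk : p ≤ k) (hkq : k ≤ q) :
    lineSum phi f1 f2 i u (2 * k + 1) ≤ lineSum phi f1 f2 i u (2 * p + 1) := by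
  refine le_of_midpoint_convex (f := fun k => lineSum phi f1 f2 i u (2 * k + 1)) hpk hkq ?_
    (lineSum_reflect hL hF1 hF2 hRP hsym i u hpq)
  intro j _ hj
  have h := two_mul_lineSum_le hL hF1 hF2 hRP hsym i u (a := j) (b := j + 2) (by omega) (by omega)
  rwa [show j + (j + 2) + 1 = 2 * (j + 1) + 1 by ring] at h

theorem exists_val_eq_of_odd_coordRep (hL : Even L) {c : ZMod L} (hc : Odd (coordRep L c)) :
    ∃ k, c.val = 2 * k + 1 := by
  have hL' : Even (L : ℤ) := by exact_mod_cast hL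
  have h : Odd (c.val : ℤ) := by
    unfold coordRep at hc
    split_ifs at hc with h
    · exact hc
    · simpa using hc.add_even hL'
  exact_mod_cast h

theorem twoPoint_update_ge (hL : Even L) (hF1 : ∀ x : Torus d L, site f1 x ∈ AL)
    (hF2 : ∀ x : Torus d L, site f2 x ∈ AL) (hRP : RPEdges AL phi)
    (hsym : TorusSymmetric phi f1 f2) {M : ℝ} (hbd : ∀ x y : Torus d L, twoPoint phi f1 f2 x y ≤ M)
    (i : Fin d) (u : Torus d L) {b c : ZMod L} (hb : Odd (coordRep L b)) (hc : Odd (coordRep L c))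
    (hbc : (b.val : ℤ) ≤ |coordRep L c| ∨ (L : ℤ) - |coordRep L c| < (b.val : ℤ)) :
    2 * twoPoint phi f1 f2 0 (Function.update u i c) - M ≤
      twoPoint phi f1 f2 0 (Function.update u i b) := by
  obtain ⟨j, hj⟩ := exists_val_eq_of_odd_coordRep hL hb
  obtain ⟨k, hk⟩ := exists_val_eq_of_odd_coordRep hL hc
  have hjL := ZMod.val_lt b
  have hkL := ZMod.val_lt c
  have hb' : b = ((2 * j + 1 : ℕ) : ZMod L) := by rw [← hj, ZMod.natCast_zmod_val]
  have hc' : c = ((2 * k + 1 : ℕ) : ZMod L) := by rw [← hk, ZMod.natCast_zmod_val]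
  have hLN : 2 * (L / 2) = L := Nat.two_mul_div_two_of_even hL
  have hmono : lineSum phi f1 f2 i u (2 * k + 1) ≤ lineSum phi f1 f2 i u (2 * j + 1) := by
    have hcase : (j ≤ k ∧ k ≤ L / 2 - 1 - j) ∨ (L / 2 - 1 - j ≤ k ∧ k ≤ j) := by
      unfold coordRep at hbc
      split_ifs at hbc with h
      · rw [abs_of_nonneg (by omega)] at hbc
        omega
      · rw [abs_of_nonpos (by omega)] at hbc
        omega
    rcases hcase with ⟨h1, h2⟩ | ⟨h1, h2⟩
    · exact lineSum_le hL hF1 hF2 hRP hsym i u (by omega) h1 h2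
    · rw [lineSum_reflect hL hF1 hF2 hRP hsym i u (a := j) (b := L / 2 - 1 - j) (by omega)]
      exact lineSum_le hL hF1 hF2 hRP hsym i u (by omega) h1 h2
  have haxis := twoPoint_update_le_axis hL hF1 hF2 hRP hsym i u (a := k) (by omega)
  have hM := hbd 0 (Function.update 0 i ((2 * j + 1 : ℕ) : ZMod L))
  unfold lineSum at hmono
  rw [hb', hc']
  linarith

end TwoPoint

/-- If `⟨·⟩` is reflection positive for reflections through edges, the two-point function is
torus symmetric and bounded by `M`, then for `y ∈ Q_z` with all coordinates of `z` and of `y`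
odd, `G_L(o,y) ≥ 2^d G_L(o,z) − (2^d − 1) M`. -/
theorem statement11 {d L : ℕ} [NeZero L] (hd : 2 ≤ d) (hL : Even L) {Sig : Type*}
    (AL : Subalgebra ℝ (MState d L Sig → ℝ)) (hfin : FiniteDimensional ℝ AL)
    (phi : (MState d L Sig → ℝ) →ₗ[ℝ] ℝ) (hone : phi 1 = 1)
    (f1 f2 : Sig → ℝ)
    (hF1 : ∀ x : Torus d L, site f1 x ∈ AL) (hF2 : ∀ x : Torus d L, site f2 x ∈ AL)
    (hRP : RPEdges AL phi) (hsym : TorusSymmetric phi f1 f2)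
    (M : ℝ) (hM : 0 < M) (hbd : ∀ x y : Torus d L, twoPoint phi f1 f2 x y ≤ M)
    (z y : Torus d L) (hy : y ∈ Qset d L z)
    (hzodd : ∀ i : Fin d, Odd (coordRep L (z i))) (hyodd : ∀ i : Fin d, Odd (coordRep L (y i))) :
    2 ^ d * twoPoint phi f1 f2 0 z - (2 ^ d - 1) * M ≤ twoPoint phi f1 f2 0 y := by
  have key : ∀ s : Finset (Fin d),
      2 ^ s.card * twoPoint phi f1 f2 0 z - (2 ^ s.card - 1) * M ≤
        twoPoint phi f1 f2 0 (s.piecewise y z) := by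
    intro s
    induction s using Finset.induction_on with
    | empty => simp
    | insert i s hi ih =>
      have h := twoPoint_update_ge hL hF1 hF2 hRP hsym hbd i (s.piecewise y z) (hyodd i) (hzodd i)
        (hy i)
      have hz : Function.update (s.piecewise y z) i (z i) = s.piecewise y z := by
        rw [Function.update_eq_self_iff, Finset.piecewise_eq_of_notMem _ _ _ hi]
      rw [hz, ← Finset.piecewise_insert] at h
      rw [Finset.card_insert_of_notMem hi, pow_succ]
      linarith
  simpa using key Finset.univ

end RPPaper
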